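/- arXiv:2110.01197 — 2 statements merged into one kernel-verified Lean document; each statement's English description precedes it below -/
import Mathlib

section
/- Let n ≥ 1 and let p⃗=(p₁,…,pₙ), s⃗=(s₁,…,sₙ) be n-tuples with 1 ≤ pᵢ, sᵢ ≤ ∞ and let 1 ≤ α ≤ ∞. Then the mixed-norm amalgam spaces (L^{p⃗},L^{s⃗})(ℝⁿ) and (L^{p⃗},L^{s⃗})^α(ℝⁿ), equipped with the norms ‖·‖_{(L^{p⃗},L^{s⃗})} and ‖·‖_{(L^{p⃗},L^{s⃗})^α} respectively, are Banach spaces: each functional is a norm (positive, homogeneous, satisfying the triangle inequality) and every Cauchy sequence converges in the corresponding norm. -/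
open MeasureTheory ENNReal Filter Topology Set

noncomputable section

namespace MixedAmalgam

/-- `L^p` norm over `ℝ` of an `ℝ≥0∞`-valued function, with the usual
modification (`essSup`) for `p = ∞`. -/
def lpInt (p : ℝ≥0∞) (g : ℝ → ℝ≥0∞) : ℝ≥0∞ :=
  if p = ∞ then essSup g volume else (∫⁻ t, g t ^ p.toReal) ^ (1 / p.toReal)

/-- `ℓ^p` norm over `ℤ` of an `ℝ≥0∞`-valued family, with the usual
modification for `p = ∞`. -/
def lpSum (p : ℝ≥0∞) (g : ℤ → ℝ≥0∞) : ℝ≥0∞ :=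
  if p = ∞ then ⨆ k, g k else (∑' k, g k ^ p.toReal) ^ (1 / p.toReal)

/-- Iterated mixed Lebesgue norm of an `ℝ≥0∞`-valued function on `ℝⁿ`,
taking the `L^{p₁}` norm in the first variable innermost, and the `L^{pₙ}`
norm in the last variable outermost. -/
def mixedE : (n : ℕ) → (Fin n → ℝ≥0∞) → ((Fin n → ℝ) → ℝ≥0∞) → ℝ≥0∞
  | 0, _, g => g Fin.elim0
  | n + 1, p, g =>
    lpInt (p (Fin.last n)) fun t =>
      mixedE n (fun i => p i.castSucc) fun x => g (Fin.snoc x t)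

/-- Mixed-norm Lebesgue norm `‖f‖_{L^{p⃗}}` of a real-valued function on `ℝⁿ`. -/
def mixedLp (n : ℕ) (p : Fin n → ℝ≥0∞) (f : (Fin n → ℝ) → ℝ) : ℝ≥0∞ :=
  mixedE n p fun x => (‖f x‖₊ : ℝ≥0∞)

/-- Iterated mixed `ℓ^{s⃗}` norm of an `ℝ≥0∞`-valued family indexed by `ℤⁿ`. -/
def mixedSeq : (n : ℕ) → (Fin n → ℝ≥0∞) → ((Fin n → ℤ) → ℝ≥0∞) → ℝ≥0∞
  | 0, _, a => a Fin.elim0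
  | n + 1, s, a =>
    lpSum (s (Fin.last n)) fun k =>
      mixedSeq n (fun i => s i.castSucc) fun m => a (Fin.snoc m k)

/-- Open Euclidean ball of center `y` and radius `r` in `ℝⁿ`. -/
def eball (n : ℕ) (y : Fin n → ℝ) (r : ℝ) : Set (Fin n → ℝ) :=
  {x | Real.sqrt (∑ i, (x i - y i) ^ 2) < r}

/-- `Σᵢ 1/pᵢ` as a real number. -/
def invSum (n : ℕ) (p : Fin n → ℝ≥0∞) : ℝ :=
  ∑ i, (1 / p i).toReal

/-- The `(L^{p⃗},L^{s⃗})` amalgam norm computed with balls of radius `r`. -/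
def amalgamNormR (n : ℕ) (p s : Fin n → ℝ≥0∞) (r : ℝ) (f : (Fin n → ℝ) → ℝ) : ℝ≥0∞ :=
  mixedE n s fun y => mixedLp n p ((eball n y r).indicator f)

/-- The amalgam norm `‖f‖_{(L^{p⃗},L^{s⃗})}`. -/
def amalgamNorm (n : ℕ) (p s : Fin n → ℝ≥0∞) (f : (Fin n → ℝ) → ℝ) : ℝ≥0∞ :=
  amalgamNormR n p s 1 f

/-- The amalgam norm `‖f‖_{(L^{p⃗},L^{s⃗})^α}`. -/
def amalgamNormA (n : ℕ) (p s : Fin n → ℝ≥0∞) (α : ℝ≥0∞) (f : (Fin n → ℝ) → ℝ) : ℝ≥0∞ :=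
  ⨆ (r : ℝ) (_ : 0 < r),
    mixedE n s fun y =>
      volume (eball n y r) ^
          ((1 / α).toReal - invSum n p / (n : ℝ) - invSum n s / (n : ℝ)) *
        mixedLp n p ((eball n y r).indicator f)

/-- The amalgam norm `‖·‖_{(L^{p⃗},L^{s⃗})^α}` for `ℝ≥0∞`-valued functions. -/
def amalgamNormAE (n : ℕ) (p s : Fin n → ℝ≥0∞) (α : ℝ≥0∞)
    (g : (Fin n → ℝ) → ℝ≥0∞) : ℝ≥0∞ :=
  ⨆ (r : ℝ) (_ : 0 < r),
    mixedE n s fun y =>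
      volume (eball n y r) ^
          ((1 / α).toReal - invSum n p / (n : ℝ) - invSum n s / (n : ℝ)) *
        mixedE n p ((eball n y r).indicator g)

/-- The cube `Q_{r,k} = r(k + [0,1)ⁿ)`. -/
def qcube (n : ℕ) (r : ℝ) (k : Fin n → ℤ) : Set (Fin n → ℝ) :=
  {x | ∀ i, r * (k i : ℝ) ≤ x i ∧ x i < r * ((k i : ℝ) + 1)}

/-- The discrete amalgam norm `_r‖f‖_{p⃗,s⃗}`. -/
def discNormR (n : ℕ) (p s : Fin n → ℝ≥0∞) (r : ℝ) (f : (Fin n → ℝ) → ℝ) : ℝ≥0∞ :=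
  mixedSeq n s fun k => mixedLp n p ((qcube n r k).indicator f)

/-- The discrete amalgam norm `‖f‖_{p⃗,s⃗} = _1‖f‖_{p⃗,s⃗}`. -/
def discNorm (n : ℕ) (p s : Fin n → ℝ≥0∞) (f : (Fin n → ℝ) → ℝ) : ℝ≥0∞ :=
  discNormR n p s 1 f

/-- The discrete amalgam norm
`‖f‖_{p⃗,s⃗,α} = sup_{r>0} r^{n/α - Σᵢ 1/pᵢ} · _r‖f‖_{p⃗,s⃗}`. -/
def discNormA (n : ℕ) (p s : Fin n → ℝ≥0∞) (α : ℝ≥0∞) (f : (Fin n → ℝ) → ℝ) : ℝ≥0∞ :=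
  ⨆ (r : ℝ) (_ : 0 < r),
    ENNReal.ofReal (r ^ ((n : ℝ) * (1 / α).toReal - invSum n p)) * discNormR n p s r f

/-- Membership in `(L^{p⃗},L^{s⃗})^α(ℝⁿ)` (continuous form). -/
def memA (n : ℕ) (p s : Fin n → ℝ≥0∞) (α : ℝ≥0∞) (f : (Fin n → ℝ) → ℝ) : Prop :=
  LocallyIntegrable f volume ∧ amalgamNormA n p s α f < ∞

/-- Membership in `(L^{p⃗},ℓ^{s⃗})(ℝⁿ)`. -/
def memD (n : ℕ) (p s : Fin n → ℝ≥0∞) (f : (Fin n → ℝ) → ℝ) : Prop :=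
  LocallyIntegrable f volume ∧ discNorm n p s f < ∞

/-- Membership in `(L^{p⃗},ℓ^{s⃗})^α(ℝⁿ)`. -/
def memDA (n : ℕ) (p s : Fin n → ℝ≥0∞) (α : ℝ≥0∞) (f : (Fin n → ℝ) → ℝ) : Prop :=
  LocallyIntegrable f volume ∧ discNormA n p s α f < ∞

/-- The dilation `St_r^{(α)} f = r^{-n/α} f(r⁻¹ ·)`. -/
def dil (n : ℕ) (α : ℝ≥0∞) (r : ℝ) (f : (Fin n → ℝ) → ℝ) : (Fin n → ℝ) → ℝ :=
  fun x => r ^ (-((n : ℝ) * (1 / α).toReal)) * f (r⁻¹ • x)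

/-- A block decomposition `f = Σ_j c_j St_{r_j}^{(α')} f_j` converging in `L¹_loc`. -/
structure BlockDecomp (n : ℕ) (p' s' : Fin n → ℝ≥0∞) (α' : ℝ≥0∞) (f : (Fin n → ℝ) → ℝ)
    (c : ℕ → ℝ) (rr : ℕ → ℝ) (g : ℕ → (Fin n → ℝ) → ℝ) : Prop where
  csummable : Summable fun j => |c j|
  rpos : ∀ j, 0 < rr j
  gloc : ∀ j, LocallyIntegrable (g j) volume
  gnorm : ∀ j, discNorm n p' s' (g j) ≤ 1
  conv : ∀ K : Set (Fin n → ℝ), IsCompact K →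
    Tendsto (fun J : ℕ =>
        ∫⁻ x in K,
          (‖f x - ∑ j ∈ Finset.range J, c j * dil n α' (rr j) (g j) x‖₊ : ℝ≥0∞))
      atTop (𝓝 0)

/-- Membership in the block space `H(p⃗',s⃗',α')`. -/
def memH (n : ℕ) (p' s' : Fin n → ℝ≥0∞) (α' : ℝ≥0∞) (f : (Fin n → ℝ) → ℝ) : Prop :=
  LocallyIntegrable f volume ∧ ∃ c rr g, BlockDecomp n p' s' α' f c rr g

/-- The norm of the block space `H(p⃗',s⃗',α')`. -/
def hNorm (n : ℕ) (p' s' : Fin n → ℝ≥0∞) (α' : ℝ≥0∞) (f : (Fin n → ℝ) → ℝ) : ℝ≥0∞ :=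
  ⨅ (c : ℕ → ℝ) (rr : ℕ → ℝ) (g : ℕ → (Fin n → ℝ) → ℝ)
    (_ : BlockDecomp n p' s' α' f c rr g), ENNReal.ofReal (∑' j, |c j|)

/-- The fractional integral operator `I_γ`. -/
def fracInt (n : ℕ) (γ : ℝ) (f : (Fin n → ℝ) → ℝ) : (Fin n → ℝ) → ℝ :=
  fun x => ∫ y, f y / Real.sqrt (∑ i, (x i - y i) ^ 2) ^ ((n : ℝ) - γ)

/-- The fractional maximal operator `M_γ`. -/
def fracMax (n : ℕ) (γ : ℝ) (f : (Fin n → ℝ) → ℝ) : (Fin n → ℝ) → ℝ≥0∞ :=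
  fun x => ⨆ (y : Fin n → ℝ) (r : ℝ) (_ : 0 < r) (_ : x ∈ eball n y r),
    volume (eball n y r) ^ (γ / (n : ℝ) - 1) * ∫⁻ z in eball n y r, (‖f z‖₊ : ℝ≥0∞)

/-- The commutator `[b, I_γ] f`. -/
def commFracInt (n : ℕ) (γ : ℝ) (b f : (Fin n → ℝ) → ℝ) : (Fin n → ℝ) → ℝ :=
  fun x => ∫ y, (b x - b y) * f y / Real.sqrt (∑ i, (x i - y i) ^ 2) ^ ((n : ℝ) - γ)

/-- The mean value `b_B` of `b` over the ball `B(y,r)`. -/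
def ballAvg (n : ℕ) (b : (Fin n → ℝ) → ℝ) (y : Fin n → ℝ) (r : ℝ) : ℝ :=
  (volume (eball n y r)).toReal⁻¹ * ∫ x in eball n y r, b x

/-- The `BMO` norm `sup_B (1/|B|) ∫_B |b - b_B|`. -/
def bmoNorm (n : ℕ) (b : (Fin n → ℝ) → ℝ) : ℝ≥0∞ :=
  ⨆ (y : Fin n → ℝ) (r : ℝ) (_ : 0 < r),
    ENNReal.ofReal
      ((volume (eball n y r)).toReal⁻¹ * ∫ x in eball n y r, |b x - ballAvg n b y r|)

lemma lpInt_eq {p : ℝ≥0∞} (hp : 1 ≤ p) (g : ℝ → ℝ≥0∞) : lpInt p g = eLpNorm g p volume := by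
  have h0 : p ≠ 0 := (zero_lt_one.trans_le hp).ne'
  unfold lpInt
  split_ifs with h
  · subst h; simp [eLpNorm_exponent_top, eLpNormEssSup]
  · rw [eLpNorm_eq_lintegral_rpow_enorm_toReal h0 h]; simp

lemma toReal_one_le {p : ℝ≥0∞} (hp : 1 ≤ p) (h : p ≠ ∞) : 1 ≤ p.toReal := by
  have := ENNReal.toReal_mono h hp; simpa using this

lemma lpInt_mono_ae {p : ℝ≥0∞} (hp : 1 ≤ p) {g h : ℝ → ℝ≥0∞} (hgh : ∀ᵐ t, g t ≤ h t) :
    lpInt p g ≤ lpInt p h := by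
  rw [lpInt_eq hp, lpInt_eq hp]
  exact eLpNorm_mono_enorm_ae (by simpa using hgh)

lemma lpInt_congr {p : ℝ≥0∞} (hp : 1 ≤ p) {g h : ℝ → ℝ≥0∞} (hgh : ∀ᵐ t, g t = h t) :
    lpInt p g = lpInt p h :=
  le_antisymm (lpInt_mono_ae hp (hgh.mono fun _ h => h.le))
    (lpInt_mono_ae hp (hgh.mono fun _ h => h.ge))

lemma lpInt_add {p : ℝ≥0∞} (hp : 1 ≤ p) {g h : ℝ → ℝ≥0∞} (hg : Measurable g)
    (hh : Measurable h) : lpInt p (fun t => g t + h t) ≤ lpInt p g + lpInt p h := by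
  rw [lpInt_eq hp, lpInt_eq hp, lpInt_eq hp]
  exact eLpNorm_add_le hg.aestronglyMeasurable hh.aestronglyMeasurable hp

lemma lpInt_mul {p : ℝ≥0∞} (hp : 1 ≤ p) {c : ℝ≥0∞} (hc : c ≠ ∞) (g : ℝ → ℝ≥0∞) :
    lpInt p (fun t => c * g t) = c * lpInt p g := by
  unfold lpInt
  split_ifs with h
  · exact ENNReal.essSup_const_mul
  · have h1 := toReal_one_le hp h
    have h0 : 0 ≤ p.toReal := by linarith
    simp_rw [ENNReal.mul_rpow_of_nonneg _ _ h0]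
    rw [lintegral_const_mul' _ _ (ENNReal.rpow_ne_top_of_nonneg h0 hc),
      ENNReal.mul_rpow_of_nonneg _ _ (by positivity), ← ENNReal.rpow_mul,
      mul_one_div_cancel (by linarith), ENNReal.rpow_one]

lemma lpInt_zero_iff {p : ℝ≥0∞} (hp : 1 ≤ p) {g : ℝ → ℝ≥0∞} (hg : Measurable g) :
    lpInt p g = 0 ↔ ∀ᵐ t, g t = 0 := by
  rw [lpInt_eq hp, eLpNorm_eq_zero_iff hg.aestronglyMeasurable (zero_lt_one.trans_le hp).ne']
  rfl

lemma lpInt_iSup {p : ℝ≥0∞} (hp : 1 ≤ p) {g : ℕ → ℝ → ℝ≥0∞} (hg : ∀ k, Measurable (g k))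
    (hm : ∀ t, Monotone fun k => g k t) :
    lpInt p (fun t => ⨆ k, g k t) ≤ ⨆ k, lpInt p (g k) := by
  unfold lpInt
  split_ifs with h
  · refine essSup_le_of_ae_le _ ?_
    have : ∀ k, ∀ᵐ t, g k t ≤ essSup (g k) volume := fun k => ENNReal.ae_le_essSup _
    filter_upwards [ae_all_iff.2 this] with t ht
    exact iSup_mono ht
  · have h1 := toReal_one_le hp h
    have h0 : 0 < p.toReal := by linarith
    have e1 : ∀ t, (⨆ k, g k t) ^ p.toReal = ⨆ k, (g k t) ^ p.toReal := fun t =>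
      (ENNReal.orderIsoRpow _ h0).map_iSup _
    simp_rw [e1]
    rw [lintegral_iSup (fun k => (hg k).pow_const _)
      (fun i j hij t => ENNReal.rpow_le_rpow (hm t hij) h0.le)]
    exact ((ENNReal.orderIsoRpow (1 / p.toReal) (by positivity)).map_iSup _).le

lemma lpInt_measurable {β : Type*} [MeasurableSpace β] (p : ℝ≥0∞) {G : β × ℝ → ℝ≥0∞}
    (hG : Measurable G) : Measurable fun b => lpInt p fun t => G (b, t) := by
  unfold lpInt
  split_ifs with h
  · apply measurable_of_Iic
    intro c
    have : (fun b => essSup (fun t => G (b, t)) volume) ⁻¹' Iic c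
        = (fun b => volume (Prod.mk b ⁻¹' {z | c < G z})) ⁻¹' {0} := by
      ext b
      simp only [mem_preimage, mem_Iic, mem_singleton_iff]
      constructor
      · intro hb
        have := ENNReal.ae_le_essSup (μ := volume) (fun t => G (b, t))
        have h2 : ∀ᵐ t, G (b, t) ≤ c := this.mono fun t ht => ht.trans hb
        rw [ae_iff] at h2
        simpa using h2
      · intro hb
        refine essSup_le_of_ae_le _ ?_
        show ∀ᵐ t, G (b, t) ≤ c
        rw [ae_iff]
        simpa using hb
    rw [this]
    exact (measurable_measure_prodMk_left (hG measurableSet_Ioi)) (measurableSet_singleton 0)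
  · exact ((hG.pow_const _).lintegral_prod_right').pow_const _

lemma lpInt_loc {p : ℝ≥0∞} (hp : 1 ≤ p) (R : ℝ) : ∃ C : ℝ≥0∞, C ≠ ∞ ∧
    ∀ g : ℝ → ℝ≥0∞, Measurable g → ∫⁻ t in Icc (-R) R, g t ≤ C * lpInt p g := by
  refine ⟨(volume.restrict (Icc (-R) R)) univ ^ (1 / (1 : ℝ≥0∞).toReal - 1 / p.toReal), ?_, ?_⟩
  · apply ENNReal.rpow_ne_top_of_nonneg
    · by_cases h : p = ∞
      · simp [h]
      · have h1 := toReal_one_le hp h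
        rw [ENNReal.toReal_one, sub_nonneg]
        exact one_div_le_one_div_of_le one_pos h1
    · simp
  · intro g hg
    rw [lpInt_eq hp, mul_comm]
    have := eLpNorm_le_eLpNorm_mul_rpow_measure_univ (f := g) (μ := volume.restrict (Icc (-R) R)) hp
      (hg.aestronglyMeasurable (μ := volume.restrict (Icc (-R) R)))
    rw [eLpNorm_one_eq_lintegral_enorm] at this
    refine le_trans (by simp) (this.trans ?_)
    gcongr
    exact Measure.restrict_le_self

lemma snoc_eq (n : ℕ) :
    (fun z : ℝ × (Fin n → ℝ) => (Fin.snoc z.2 z.1 : Fin (n + 1) → ℝ)) =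
    (MeasurableEquiv.piFinSuccAbove (fun _ : Fin (n + 1) => ℝ) (Fin.last n)).symm := by
  funext z
  exact (Fin.insertNth_last' z.1 z.2).symm

lemma snoc_mp (n : ℕ) : MeasurePreserving
    (fun z : ℝ × (Fin n → ℝ) => (Fin.snoc z.2 z.1 : Fin (n + 1) → ℝ)) (volume.prod volume)
    volume := by
  rw [snoc_eq]
  exact (volume_preserving_piFinSuccAbove (fun _ : Fin (n + 1) => ℝ) (Fin.last n)).symm

lemma snoc_me (n : ℕ) : MeasurableEmbedding
    (fun z : ℝ × (Fin n → ℝ) => (Fin.snoc z.2 z.1 : Fin (n + 1) → ℝ)) := by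
  rw [snoc_eq]
  exact MeasurableEquiv.measurableEmbedding _

lemma snoc_ae {n : ℕ} {P : (Fin (n + 1) → ℝ) → Prop} (h : ∀ᵐ x, P x) :
    ∀ᵐ t : ℝ, ∀ᵐ x : Fin n → ℝ, P (Fin.snoc x t) :=
  Measure.ae_ae_of_ae_prod ((snoc_mp n).quasiMeasurePreserving.ae h)

lemma snoc_ae_iff {n : ℕ} {P : (Fin (n + 1) → ℝ) → Prop} (hP : MeasurableSet {x | P x}) :
    (∀ᵐ x, P x) ↔ ∀ᵐ t : ℝ, ∀ᵐ x : Fin n → ℝ, P (Fin.snoc x t) := by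
  refine ⟨snoc_ae, fun h => ?_⟩
  have h2 := (Measure.ae_prod_iff_ae_ae (μ := (volume : Measure ℝ))
    (ν := (volume : Measure (Fin n → ℝ))) (p := fun z => P (Fin.snoc z.2 z.1))
    ((snoc_mp n).measurable hP)).2 h
  rw [← (snoc_mp n).map_eq, (snoc_me n).ae_map_iff]
  exact h2

lemma snoc_lintegral {n : ℕ} {g : (Fin (n + 1) → ℝ) → ℝ≥0∞} (hg : Measurable g) :
    ∫⁻ x, g x = ∫⁻ t : ℝ, ∫⁻ x : Fin n → ℝ, g (Fin.snoc x t) := by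
  rw [← (snoc_mp n).lintegral_comp hg, lintegral_prod]
  exact (hg.comp (snoc_mp n).measurable).aemeasurable

lemma slice_meas {n : ℕ} {g : (Fin (n + 1) → ℝ) → ℝ≥0∞} (hg : Measurable g) (t : ℝ) :
    Measurable fun x : Fin n → ℝ => g (Fin.snoc x t) :=
  hg.comp ((snoc_mp n).measurable.comp measurable_prodMk_left)

lemma mixedE_mono : ∀ {n : ℕ} {p : Fin n → ℝ≥0∞}, (∀ i, 1 ≤ p i) →
    ∀ {g h : (Fin n → ℝ) → ℝ≥0∞}, (∀ x, g x ≤ h x) → mixedE n p g ≤ mixedE n p h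
  | 0, _, _, _, _, H => H _
  | _ + 1, _, hp, _, _, H => lpInt_mono_ae (hp _) (ae_of_all _ fun _ =>
      mixedE_mono (fun _ => hp _) fun _ => H _)

lemma mixedE_congr : ∀ {n : ℕ} {p : Fin n → ℝ≥0∞}, (∀ i, 1 ≤ p i) →
    ∀ {g h : (Fin n → ℝ) → ℝ≥0∞}, (∀ᵐ x, g x = h x) → mixedE n p g = mixedE n p h
  | 0, p, hp, g, h, H => by
      have := H.exists
      obtain ⟨x, hx⟩ := this
      have e : x = Fin.elim0 := Subsingleton.elim _ _
      subst e
      exact hx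
  | n + 1, p, hp, g, h, H => lpInt_congr (hp _) ((snoc_ae H).mono fun _ ht =>
      mixedE_congr (fun _ => hp _) ht)

lemma mixedE_measurable {n : ℕ} (p : Fin n → ℝ≥0∞) {β : Type} [MeasurableSpace β]
    {G : β × (Fin n → ℝ) → ℝ≥0∞} (hG : Measurable G) :
    Measurable fun b => mixedE n p fun x => G (b, x) := by
  induction n generalizing β with
  | zero =>
      show Measurable fun b => G (b, Fin.elim0)
      exact hG.comp measurable_prodMk_right
  | succ n ih =>
      have := ih (β := β × ℝ) (fun i => p i.castSucc)
        (G := fun w => G (w.1.1, Fin.snoc w.2 w.1.2))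
        (hG.comp ((measurable_fst.comp measurable_fst).prodMk
          ((snoc_mp n).measurable.comp
            ((measurable_snd.comp measurable_fst).prodMk measurable_snd))))
      have h2 := lpInt_measurable (p (Fin.last n)) (G := fun z : β × ℝ =>
        mixedE n (fun i => p i.castSucc) fun x => G (z.1, Fin.snoc x z.2)) this
      simp only [mixedE]
      exact h2

lemma mixedE_slice {n : ℕ} (p : Fin n → ℝ≥0∞) {g : (Fin (n + 1) → ℝ) → ℝ≥0∞}
    (hg : Measurable g) :
    Measurable fun t => mixedE n p fun x => g (Fin.snoc x t) :=
  mixedE_measurable p (G := fun z : ℝ × (Fin n → ℝ) => g (Fin.snoc z.2 z.1))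
    (hg.comp (snoc_mp n).measurable)

lemma mixedE_add : ∀ {n : ℕ} {p : Fin n → ℝ≥0∞}, (∀ i, 1 ≤ p i) →
    ∀ {g h : (Fin n → ℝ) → ℝ≥0∞}, Measurable g → Measurable h →
    mixedE n p (fun x => g x + h x) ≤ mixedE n p g + mixedE n p h
  | 0, _, _, _, _, _, _ => le_rfl
  | _ + 1, _, hp, _, _, hg, hh =>
      (lpInt_mono_ae (hp _) (ae_of_all _ fun t => mixedE_add (fun _ => hp _)
        (slice_meas hg t) (slice_meas hh t))).trans
      (lpInt_add (hp _) (mixedE_slice _ hg) (mixedE_slice _ hh))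

lemma mixedE_mul : ∀ {n : ℕ} {p : Fin n → ℝ≥0∞}, (∀ i, 1 ≤ p i) →
    ∀ {c : ℝ≥0∞}, c ≠ ∞ → ∀ (g : (Fin n → ℝ) → ℝ≥0∞),
    mixedE n p (fun x => c * g x) = c * mixedE n p g
  | 0, _, _, _, _, _ => rfl
  | _ + 1, _, hp, _, hc, g =>
      (lpInt_congr (hp _) (ae_of_all _ fun t => mixedE_mul (fun _ => hp _) hc
        (fun x => g (Fin.snoc x t)))).trans (lpInt_mul (hp _) hc _)

lemma mixedE_zero_iff : ∀ {n : ℕ} {p : Fin n → ℝ≥0∞}, (∀ i, 1 ≤ p i) →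
    ∀ {g : (Fin n → ℝ) → ℝ≥0∞}, Measurable g → (mixedE n p g = 0 ↔ ∀ᵐ x, g x = 0)
  | 0, p, hp, g, hg => by
      constructor
      · intro h
        refine ae_of_all _ fun x => ?_
        have e : x = Fin.elim0 := Subsingleton.elim _ _
        subst e
        exact h
      · intro H
        obtain ⟨x, hx⟩ := H.exists
        have e : x = Fin.elim0 := Subsingleton.elim _ _
        subst e
        exact hx
  | n + 1, p, hp, g, hg => by
      rw [snoc_ae_iff (P := fun x => g x = 0) (hg (measurableSet_singleton 0))]
      refine (lpInt_zero_iff (hp _) (mixedE_slice _ hg)).trans ?_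
      refine eventually_congr (ae_of_all _ fun t => ?_)
      exact mixedE_zero_iff (fun _ => hp _) (slice_meas hg t)

lemma mixedE_iSup : ∀ {n : ℕ} {p : Fin n → ℝ≥0∞}, (∀ i, 1 ≤ p i) →
    ∀ {g : ℕ → (Fin n → ℝ) → ℝ≥0∞}, (∀ k, Measurable (g k)) → (∀ x, Monotone fun k => g k x) →
    mixedE n p (fun x => ⨆ k, g k x) ≤ ⨆ k, mixedE n p (g k)
  | 0, _, _, _, _, _ => le_rfl
  | _ + 1, _, hp, _, hg, hm =>
      (lpInt_mono_ae (hp _) (ae_of_all _ fun t => mixedE_iSup (fun _ => hp _)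
        (fun k => slice_meas (hg k) t) (fun _ => hm _))).trans
      (lpInt_iSup (hp _) (fun k => mixedE_slice _ (hg k))
        (fun _ _ _ hij => mixedE_mono (fun _ => hp _) fun _ => hm _ hij))

/-- The cube of half-side `R`. -/
def cubeR (n : ℕ) (R : ℝ) : Set (Fin n → ℝ) := {x | ∀ i, x i ∈ Icc (-R) R}

lemma cubeR_meas (n : ℕ) (R : ℝ) : MeasurableSet (cubeR n R) := by
  have : cubeR n R = Set.pi univ fun _ => Icc (-R) R := by
    ext; simp only [cubeR, Set.mem_pi, mem_univ, true_imp_iff]; rfl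
  rw [this]
  exact MeasurableSet.univ_pi fun _ => measurableSet_Icc

lemma mixedE_loc : ∀ {n : ℕ} {p : Fin n → ℝ≥0∞}, (∀ i, 1 ≤ p i) → ∀ (R : ℝ),
    ∃ C : ℝ≥0∞, C ≠ ∞ ∧ ∀ g : (Fin n → ℝ) → ℝ≥0∞, Measurable g →
      ∫⁻ x in cubeR n R, g x ≤ C * mixedE n p g
  | 0, p, hp, R => by
      refine ⟨1, by simp, fun g hg => ?_⟩
      refine (setLIntegral_le_lintegral _ _).trans ?_
      have : g = fun _ => g Fin.elim0 := by
        funext x; congr 1; exact Subsingleton.elim _ _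
      rw [this]
      simp [mixedE, volume_pi]
  | n + 1, p, hp, R => by
      obtain ⟨C, hC, H⟩ := mixedE_loc (n := n) (p := fun i => p i.castSucc) (fun _ => hp _) R
      obtain ⟨C', hC', H'⟩ := lpInt_loc (hp (Fin.last n)) R
      refine ⟨C * C', ENNReal.mul_ne_top hC hC', fun g hg => ?_⟩
      rw [← lintegral_indicator (cubeR_meas _ _), snoc_lintegral
        (hg.indicator (cubeR_meas _ _))]
      calc _ ≤ ∫⁻ t in Icc (-R) R, C * mixedE n (fun i => p i.castSucc) fun x => g (Fin.snoc x t) := by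
            rw [← lintegral_indicator measurableSet_Icc]
            refine lintegral_mono fun t => ?_
            by_cases ht : t ∈ Icc (-R) R
            · rw [indicator_of_mem ht]
              refine le_trans (le_of_eq ?_) (H _ (slice_meas hg t))
              rw [← lintegral_indicator (cubeR_meas _ _)]
              refine lintegral_congr fun x => ?_
              have : (Fin.snoc x t : Fin (n + 1) → ℝ) ∈ cubeR (n + 1) R ↔ x ∈ cubeR n R := by
                simp only [cubeR, mem_ofPred_eq, Fin.forall_fin_succ', Fin.snoc_castSucc,
                  Fin.snoc_last, ht, and_true]
              by_cases hx : x ∈ cubeR n R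
              · rw [indicator_of_mem hx, indicator_of_mem (this.2 hx)]
              · rw [indicator_of_notMem hx, indicator_of_notMem (mt this.1 hx)]
            · rw [indicator_of_notMem ht]
              refine le_of_eq ?_
              rw [← lintegral_zero (μ := (volume : Measure (Fin n → ℝ)))]
              refine lintegral_congr fun x => ?_
              rw [indicator_of_notMem]
              intro hx
              have := hx (Fin.last n)
              rw [Fin.snoc_last] at this
              exact ht this
        _ = C * ∫⁻ t in Icc (-R) R, mixedE n (fun i => p i.castSucc) fun x => g (Fin.snoc x t) :=
            lintegral_const_mul' _ _ hC
        _ ≤ C * (C' * mixedE (n + 1) p g) := by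
            gcongr
            exact H' _ (mixedE_slice _ hg)
        _ = _ := by ring

lemma exists_cubeR {n : ℕ} {K : Set (Fin n → ℝ)} (hK : Bornology.IsBounded K) :
    ∃ R, K ⊆ cubeR n R := by
  obtain ⟨R, hR⟩ := hK.subset_closedBall 0
  refine ⟨R, fun x hx i => ?_⟩
  have := hR hx
  rw [mem_closedBall_zero_iff] at this
  have h2 := (norm_le_pi_norm x i).trans this
  rw [Real.norm_eq_abs, abs_le] at h2
  exact h2

lemma mixedE_loc' {n : ℕ} {p : Fin n → ℝ≥0∞} (hp : ∀ i, 1 ≤ p i) {g : (Fin n → ℝ) → ℝ≥0∞}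
    (hg : Measurable g) (h : mixedE n p g ≠ ∞) {K : Set (Fin n → ℝ)}
    (hK : Bornology.IsBounded K) : ∫⁻ x in K, g x ≠ ∞ := by
  obtain ⟨R, hR⟩ := exists_cubeR hK
  obtain ⟨C, hC, H⟩ := mixedE_loc hp R
  exact ne_top_of_le_ne_top (ENNReal.mul_ne_top hC h)
    ((lintegral_mono_set hR).trans (H g hg))

lemma ae_lt_top_of_loc {n : ℕ} {g : (Fin n → ℝ) → ℝ≥0∞} (hg : Measurable g)
    (h : ∀ K : Set (Fin n → ℝ), IsCompact K → ∫⁻ x in K, g x ≠ ∞) : ∀ᵐ x, g x < ∞ := by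
  have : ∀ m : ℕ, ∀ᵐ x, x ∈ Metric.closedBall (0 : Fin n → ℝ) m → g x < ∞ := fun m => by
    have := ae_lt_top (μ := volume.restrict (Metric.closedBall (0 : Fin n → ℝ) m)) hg
      (h _ (isCompact_closedBall _ _))
    exact (ae_restrict_iff' Metric.isClosed_closedBall.measurableSet).1 this
  filter_upwards [ae_all_iff.2 this] with x hx
  obtain ⟨m, hm⟩ := exists_nat_ge ‖x‖
  exact hx m (by simpa using hm)

/-- Abstract Banach function norms. -/
structure IsFNorm (n : ℕ) (N : ((Fin n → ℝ) → ℝ≥0∞) → ℝ≥0∞) : Prop where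
  mono : ∀ {g h : (Fin n → ℝ) → ℝ≥0∞}, (∀ x, g x ≤ h x) → N g ≤ N h
  congr : ∀ {g h : (Fin n → ℝ) → ℝ≥0∞}, (∀ᵐ x, g x = h x) → N g = N h
  add : ∀ {g h : (Fin n → ℝ) → ℝ≥0∞}, Measurable g → Measurable h →
    N (fun x => g x + h x) ≤ N g + N h
  mul : ∀ {c : ℝ≥0∞}, c ≠ ∞ → ∀ g : (Fin n → ℝ) → ℝ≥0∞, N (fun x => c * g x) = c * N g
  zero : ∀ {g : (Fin n → ℝ) → ℝ≥0∞}, Measurable g → (N g = 0 ↔ ∀ᵐ x, g x = 0)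
  sup : ∀ {g : ℕ → (Fin n → ℝ) → ℝ≥0∞}, (∀ k, Measurable (g k)) →
    (∀ x, Monotone fun k => g k x) → N (fun x => ⨆ k, g k x) ≤ ⨆ k, N (g k)
  loc : ∀ {g : (Fin n → ℝ) → ℝ≥0∞}, Measurable g → N g ≠ ∞ →
    ∀ K : Set (Fin n → ℝ), IsCompact K → ∫⁻ x in K, g x ≠ ∞

namespace IsFNorm

variable {n : ℕ} {N : ((Fin n → ℝ) → ℝ≥0∞) → ℝ≥0∞}

lemma mono_ae (hN : IsFNorm n N) {g h : (Fin n → ℝ) → ℝ≥0∞} (H : ∀ᵐ x, g x ≤ h x) :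
    N g ≤ N h := by
  have : N g = N (fun x => min (g x) (h x)) :=
    hN.congr (H.mono fun x hx => (min_eq_left hx).symm)
  rw [this]
  exact hN.mono fun x => min_le_right _ _

lemma tsum (hN : IsFNorm n N) {g : ℕ → (Fin n → ℝ) → ℝ≥0∞} (hg : ∀ k, Measurable (g k)) :
    N (fun x => ∑' k, g k x) ≤ ∑' k, N (g k) := by
  have hfin : ∀ m : ℕ, N (fun x => ∑ k ∈ Finset.range m, g k x) ≤
      ∑ k ∈ Finset.range m, N (g k) := by
    intro m
    induction m with
    | zero =>
      simp only [Finset.range_zero, Finset.sum_empty]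
      exact ((hN.zero measurable_const).2 (ae_of_all _ fun _ => rfl)).le
    | succ m ih =>
      simp only [Finset.sum_range_succ]
      exact (hN.add (Finset.measurable_sum _ fun k _ => hg k) (hg m)).trans (by gcongr)
  simp_rw [ENNReal.tsum_eq_iSup_nat]
  refine (hN.sup (fun k => Finset.measurable_sum _ fun k _ => hg k) (fun x i j hij => ?_)).trans
    (iSup_mono hfin)
  exact Finset.sum_le_sum_of_subset (Finset.range_mono hij)

lemma fatou (hN : IsFNorm n N) {g : ℕ → (Fin n → ℝ) → ℝ≥0∞} (hg : ∀ k, Measurable (g k))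
    {ε : ℝ≥0∞} {m : ℕ} (hε : ∀ k ≥ m, N (g k) ≤ ε) :
    N (fun x => liminf (fun k => g k x) atTop) ≤ ε := by
  simp_rw [liminf_eq_iSup_iInf_of_nat]
  refine (hN.sup (fun k => Measurable.iInf fun i => Measurable.iInf fun _ => hg i)
    (fun x i j hij => ?_)).trans ?_
  · exact le_iInf₂ fun l hl => iInf₂_le l (hij.trans hl)
  · refine iSup_le fun k => ?_
    refine le_trans (hN.mono fun x => ?_) (hε (max k m) (le_max_right _ _))
    exact iInf₂_le (max k m) (le_max_left _ _)

/-- The functional on real functions. -/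
def app (N : ((Fin n → ℝ) → ℝ≥0∞) → ℝ≥0∞) (f : (Fin n → ℝ) → ℝ) : ℝ≥0∞ :=
  N fun x => (‖f x‖₊ : ℝ≥0∞)

lemma meas_nn {f : (Fin n → ℝ) → ℝ} (hf : Measurable f) :
    Measurable fun x => (‖f x‖₊ : ℝ≥0∞) := hf.nnnorm.coe_nnreal_ennreal

lemma app_congr (hN : IsFNorm n N) {f g : (Fin n → ℝ) → ℝ} (h : f =ᵐ[volume] g) :
    app N f = app N g := hN.congr (h.mono fun x hx => by simp only [hx])

lemma app_add (hN : IsFNorm n N) {f g : (Fin n → ℝ) → ℝ} (hf : AEMeasurable f)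
    (hg : AEMeasurable g) : app N (f + g) ≤ app N f + app N g := by
  rw [hN.app_congr hf.ae_eq_mk, hN.app_congr hg.ae_eq_mk,
    hN.app_congr (hf.ae_eq_mk.add hg.ae_eq_mk)]
  refine le_trans (hN.mono fun x => ?_) (hN.add (meas_nn hf.measurable_mk)
    (meas_nn hg.measurable_mk))
  rw [← ENNReal.coe_add, ENNReal.coe_le_coe]
  exact nnnorm_add_le _ _

lemma app_smul (hN : IsFNorm n N) (c : ℝ) (f : (Fin n → ℝ) → ℝ) :
    app N (c • f) = (‖c‖₊ : ℝ≥0∞) * app N f := by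
  unfold app
  rw [← hN.mul ENNReal.coe_ne_top]
  simp [nnnorm_mul]

lemma app_zero (hN : IsFNorm n N) {f : (Fin n → ℝ) → ℝ} (hf : AEMeasurable f) :
    app N f = 0 ↔ f =ᵐ[volume] 0 := by
  rw [hN.app_congr hf.ae_eq_mk]
  refine (hN.zero (meas_nn hf.measurable_mk)).trans ?_
  simp only [ENNReal.coe_eq_zero, nnnorm_eq_zero]
  constructor
  · intro h
    exact hf.ae_eq_mk.trans h
  · intro h
    exact hf.ae_eq_mk.symm.trans h

lemma app_sub_comm (f g : (Fin n → ℝ) → ℝ) : app N (f - g) = app N (g - f) := by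
  unfold app
  congr 1
  funext x
  simp only [Pi.sub_apply]
  rw [← nnnorm_neg, neg_sub]

lemma app_loc (hN : IsFNorm n N) {f : (Fin n → ℝ) → ℝ} (hf : Measurable f) (h : app N f ≠ ∞) :
    LocallyIntegrable f volume := by
  rw [locallyIntegrable_iff]
  intro K hK
  refine ⟨hf.aestronglyMeasurable, ?_⟩
  exact (hN.loc (meas_nn hf) h K hK).lt_top

theorem complete (hN : IsFNorm n N) (F : ℕ → (Fin n → ℝ) → ℝ)
    (hF : ∀ j, LocallyIntegrable (F j) volume) (hfin : ∀ j, app N (F j) < ∞)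
    (hC : ∀ ε : ℝ≥0∞, 0 < ε → ∃ M : ℕ, ∀ j ≥ M, ∀ k ≥ M, app N (F j - F k) < ε) :
    ∃ f : (Fin n → ℝ) → ℝ, LocallyIntegrable f volume ∧ app N f < ∞ ∧
        Tendsto (fun j => app N (F j - f)) atTop (𝓝 0) := by
  have hm : ∀ j, AEMeasurable (F j) := fun j => (hF j).aestronglyMeasurable.aemeasurable
  let G : ℕ → (Fin n → ℝ) → ℝ := fun j => (hm j).mk
  have hG : ∀ j, Measurable (G j) := fun j => (hm j).measurable_mk
  have hFG : ∀ j, F j =ᵐ[volume] G j := fun j => (hm j).ae_eq_mk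
  have hCG : ∀ ε : ℝ≥0∞, 0 < ε → ∃ M : ℕ, ∀ j ≥ M, ∀ k ≥ M, app N (G j - G k) < ε := by
    intro ε hε
    obtain ⟨M, hM⟩ := hC ε hε
    refine ⟨M, fun j hj k hk => ?_⟩
    rw [← hN.app_congr ((hFG j).sub (hFG k))]
    exact hM j hj k hk
  have hpos : ∀ i : ℕ, (0 : ℝ≥0∞) < 2⁻¹ ^ i := fun i =>
    ENNReal.pow_pos (by simp) i
  choose M hM using fun i : ℕ => hCG (2⁻¹ ^ i) (hpos i)
  -- subsequence
  let φ : ℕ → ℕ := fun i => i + ∑ l ∈ Finset.range (i + 1), M l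
  have hφM : ∀ i, M i ≤ φ i := fun i => by
    have : M i ≤ ∑ l ∈ Finset.range (i + 1), M l :=
      Finset.single_le_sum (f := M) (fun _ _ => Nat.zero_le _) (by simp)
    simp only [φ]; omega
  have hφs : ∀ i, φ i ≤ φ (i + 1) := fun i => by
    simp only [φ]; rw [Finset.sum_range_succ _ (i + 1)]; omega
  have hφid : ∀ i, i ≤ φ i := fun i => by simp only [φ]; omega
  have hstep : ∀ i, app N (G (φ i) - G (φ (i + 1))) ≤ 2⁻¹ ^ i := fun i =>
    (hM i _ (hφM i) _ ((hφM i).trans (hφs i))).le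
  have hd : ∀ i, Measurable fun x => (‖(G (φ i) - G (φ (i + 1))) x‖₊ : ℝ≥0∞) := fun i =>
    meas_nn ((hG _).sub (hG _))
  have hT : N (fun x => ∑' i, (‖(G (φ i) - G (φ (i + 1))) x‖₊ : ℝ≥0∞)) ≠ ∞ := by
    refine ne_top_of_le_ne_top ?_ ((hN.tsum hd).trans (ENNReal.tsum_le_tsum hstep))
    rw [ENNReal.tsum_geometric]
    simp
  have hTae := ae_lt_top_of_loc (Measurable.tsum hd)
    (hN.loc (Measurable.tsum hd) hT)
  have hlim : ∀ᵐ x, ∃ l : ℝ, Tendsto (fun i => G (φ i) x) atTop (𝓝 l) := by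
    filter_upwards [hTae] with x hx
    apply cauchySeq_tendsto_of_complete
    refine cauchySeq_of_edist_le_of_tsum_ne_top _ (fun i => ?_) hx.ne
    rw [edist_eq_enorm_sub]
    exact le_rfl
  obtain ⟨f, hf, hfl⟩ := measurable_limit_of_tendsto_metrizable_ae
    (fun i => (hG (φ i)).aemeasurable) hlim
  have key : ∀ ε : ℝ≥0∞, 0 < ε → ∃ M : ℕ, ∀ j ≥ M, app N (G j - f) ≤ ε := by
    intro ε hε
    obtain ⟨M, hM⟩ := hCG ε hε
    refine ⟨M, fun j hj => ?_⟩
    refine le_trans (hN.mono_ae ?_) (hN.fatou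
      (g := fun i x => (‖(G j - G (φ i)) x‖₊ : ℝ≥0∞))
      (fun i => meas_nn ((hG _).sub (hG _)))
      (m := M) (fun i hi => (hM j hj (φ i) (hi.le.trans (hφid i))).le))
    filter_upwards [hfl] with x hx
    have : Tendsto (fun i => (‖(G j - G (φ i)) x‖₊ : ℝ≥0∞)) atTop
        (𝓝 (‖(G j - f) x‖₊ : ℝ≥0∞)) :=
      ENNReal.tendsto_coe.2 ((tendsto_const_nhds.sub hx).nnnorm)
    exact this.liminf_eq.ge
  obtain ⟨j, hj⟩ := key 1 one_pos
  have hj := hj j le_rfl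
  have hffin : app N f < ∞ := by
    have e : f = G j + (f - G j) := by simp
    rw [e]
    refine (hN.app_add (hG j).aemeasurable (hf.sub (hG j)).aemeasurable).trans_lt ?_
    rw [app_sub_comm, ← hN.app_congr (hFG j)]
    exact ENNReal.add_lt_top.2 ⟨hfin j, hj.trans_lt ENNReal.one_lt_top⟩
  refine ⟨f, hN.app_loc hf hffin.ne, hffin, ?_⟩
  rw [ENNReal.tendsto_atTop_zero]
  intro ε hε
  obtain ⟨M, hM⟩ := key ε hε
  refine ⟨M, fun j hj => ?_⟩
  rw [hN.app_congr ((hFG j).sub (EventuallyEq.refl _ f))]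
  exact hM j hj

end IsFNorm

lemma eball_cont (n : ℕ) :
    Continuous fun z : (Fin n → ℝ) × (Fin n → ℝ) => Real.sqrt (∑ i, (z.2 i - z.1 i) ^ 2) := by
  fun_prop

lemma eball_open (n : ℕ) (y : Fin n → ℝ) (r : ℝ) : IsOpen (eball n y r) :=
  isOpen_lt (f := fun x : Fin n → ℝ => Real.sqrt (∑ i, (x i - y i) ^ 2)) (by fun_prop)
    continuous_const

lemma eball_meas2 (n : ℕ) (r : ℝ) :
    MeasurableSet {z : (Fin n → ℝ) × (Fin n → ℝ) | z.2 ∈ eball n z.1 r} :=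
  (isOpen_lt (eball_cont n) continuous_const).measurableSet

lemma eball_self (n : ℕ) (y : Fin n → ℝ) {r : ℝ} (hr : 0 < r) : y ∈ eball n y r := by
  show Real.sqrt (∑ i, (y i - y i) ^ 2) < r
  simpa using hr

lemma eball_symm {n : ℕ} {x y : Fin n → ℝ} {r : ℝ} (h : x ∈ eball n y r) : y ∈ eball n x r := by
  have h' : Real.sqrt (∑ i, (x i - y i) ^ 2) < r := h
  show Real.sqrt (∑ i, (y i - x i) ^ 2) < r
  have : ∀ i, (y i - x i) ^ 2 = (x i - y i) ^ 2 := fun i => by ring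
  simpa only [this] using h'

lemma eball_bdd (n : ℕ) (y : Fin n → ℝ) {r : ℝ} (hr : 0 < r) :
    Bornology.IsBounded (eball n y r) := by
  refine Metric.isBounded_closedBall.subset (s := eball n y r)
    (t := Metric.closedBall y r) fun x hx => ?_
  have h' : Real.sqrt (∑ i, (x i - y i) ^ 2) < r := hx
  rw [mem_closedBall_iff_norm, pi_norm_le_iff_of_nonneg hr.le]
  intro i
  rw [Real.norm_eq_abs, ← Real.sqrt_sq_eq_abs]
  refine le_trans (Real.sqrt_le_sqrt ?_) h'.le
  exact Finset.single_le_sum (f := fun i => (x i - y i) ^ 2) (fun _ _ => sq_nonneg _)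
    (Finset.mem_univ i)

lemma eball_pow_ne_top (n : ℕ) (y : Fin n → ℝ) {r : ℝ} (hr : 0 < r) (e : ℝ) :
    volume (eball n y r) ^ e ≠ ∞ := by
  have h0 : volume (eball n y r) ≠ 0 :=
    ((eball_open n y r).measure_pos volume ⟨y, eball_self n y hr⟩).ne'
  have h1 : volume (eball n y r) ≠ ∞ := (eball_bdd n y hr).measure_lt_top.ne
  exact ENNReal.rpow_ne_top_of_ne_zero h0 h1

lemma eball_pow_ne_zero (n : ℕ) (y : Fin n → ℝ) {r : ℝ} (hr : 0 < r) (e : ℝ) :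
    volume (eball n y r) ^ e ≠ 0 := by
  have h0 : volume (eball n y r) ≠ 0 :=
    ((eball_open n y r).measure_pos volume ⟨y, eball_self n y hr⟩).ne'
  have h1 : volume (eball n y r) ≠ ∞ := (eball_bdd n y hr).measure_lt_top.ne
  exact (ENNReal.rpow_pos (pos_iff_ne_zero.2 h0) h1).ne'

/-- Inner function. -/
def inn (n : ℕ) (p : Fin n → ℝ≥0∞) (e r : ℝ) (g : (Fin n → ℝ) → ℝ≥0∞) (y : Fin n → ℝ) : ℝ≥0∞ :=
  volume (eball n y r) ^ e * mixedE n p ((eball n y r).indicator g)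

/-- The general amalgam functional. -/
def NN (n : ℕ) (p s : Fin n → ℝ≥0∞) (e : ℝ) (S : Set ℝ) (g : (Fin n → ℝ) → ℝ≥0∞) : ℝ≥0∞ :=
  ⨆ (r : ℝ) (_ : r ∈ S), mixedE n s (inn n p e r g)

lemma inn_meas (n : ℕ) (p : Fin n → ℝ≥0∞) (e r : ℝ) {g : (Fin n → ℝ) → ℝ≥0∞}
    (hg : Measurable g) : Measurable (inn n p e r g) := by
  refine Measurable.mul ?_ ?_
  · exact (measurable_measure_prodMk_left (eball_meas2 n r)).pow_const _
  · have := mixedE_measurable p (β := Fin n → ℝ)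
      (G := {z : (Fin n → ℝ) × (Fin n → ℝ) | z.2 ∈ eball n z.1 r}.indicator fun z => g z.2)
      ((hg.comp measurable_snd).indicator (eball_meas2 n r))
    exact this

lemma ind_meas (n : ℕ) (y : Fin n → ℝ) (r : ℝ) {g : (Fin n → ℝ) → ℝ≥0∞}
    (hg : Measurable g) : Measurable ((eball n y r).indicator g) :=
  hg.indicator (eball_open n y r).measurableSet

/-- If a property holds for a.e. center, every point has a good ball around it. -/
lemma exists_center {n : ℕ} {r : ℝ} (hr : 0 < r) {P : (Fin n → ℝ) → Prop} (h : ∀ᵐ y, P y)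
    (x : Fin n → ℝ) : ∃ y, P y ∧ x ∈ eball n y r := by
  have hd : Dense {y | P y} := Measure.dense_of_ae h
  obtain ⟨y, hy, hP⟩ := hd.inter_open_nonempty _ (eball_open n x r) ⟨x, eball_self n x hr⟩
  exact ⟨y, hP, eball_symm hy⟩

lemma isFNorm (n : ℕ) {p s : Fin n → ℝ≥0∞} (hp : ∀ i, 1 ≤ p i) (hs : ∀ i, 1 ≤ s i) (e : ℝ)
    {S : Set ℝ} (hS : ∀ r ∈ S, 0 < r) (hne : S.Nonempty) : IsFNorm n (NN n p s e S) where
  mono {g h} H := by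
    refine iSup₂_mono fun r _ => mixedE_mono hs fun y => ?_
    unfold inn
    gcongr
    exact mixedE_mono hp fun x => indicator_le_indicator (H x)
  congr {g h} H := by
    refine iSup_congr fun r => iSup_congr fun _ => ?_
    congr 1
    funext y
    unfold inn
    congr 1
    refine mixedE_congr hp (H.mono fun x hx => ?_)
    simp only [indicator, hx]
  add {g h} hg hh := by
    refine iSup₂_le fun r hr => ?_
    refine le_trans ?_ (add_le_add
      (le_iSup₂ (f := fun (r : ℝ) (_ : r ∈ S) => mixedE n s (inn n p e r g)) r hr)
      (le_iSup₂ (f := fun (r : ℝ) (_ : r ∈ S) => mixedE n s (inn n p e r h)) r hr))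
    refine le_trans (mixedE_mono hs fun y => ?_)
      (mixedE_add hs (inn_meas n p e r hg) (inn_meas n p e r hh))
    unfold inn
    rw [← mul_add]
    gcongr
    refine le_trans (le_of_eq ?_) (mixedE_add hp (ind_meas n y r hg) (ind_meas n y r hh))
    congr 1
    exact indicator_add _ _ _
  mul {c} hc g := by
    unfold NN
    simp_rw [ENNReal.mul_iSup]
    refine iSup_congr fun r => iSup_congr fun _ => ?_
    rw [← mixedE_mul hs hc]
    congr 1
    funext y
    unfold inn
    rw [mul_left_comm, ← mixedE_mul hp hc]
    congr 2
    funext x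
    by_cases hx : x ∈ eball n y r <;> simp [hx]
  zero {g} hg := by
    constructor
    · intro h
      obtain ⟨r, hr⟩ := hne
      have h1 : mixedE n s (inn n p e r g) = 0 := by
        have := le_iSup₂ (f := fun (r : ℝ) (_ : r ∈ S) => mixedE n s (inn n p e r g)) r hr
        exact le_antisymm (this.trans h.le) zero_le
      rw [mixedE_zero_iff hs (inn_meas n p e r hg)] at h1
      have h2 : ∀ᵐ y, ∀ᵐ x, (eball n y r).indicator g x = 0 := by
        filter_upwards [h1] with y hy
        rw [← mixedE_zero_iff hp (ind_meas n y r hg)]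
        exact (mul_eq_zero.1 hy).resolve_left (eball_pow_ne_zero n y (hS r hr) e)
      rw [ae_iff]
      refine measure_null_of_locally_null _ fun x _ => ?_
      obtain ⟨y, hy, hxy⟩ := exists_center (hS r hr) h2 x
      refine ⟨eball n y r ∩ {a | ¬ g a = 0}, inter_mem
        (mem_nhdsWithin_of_mem_nhds ((eball_open n y r).mem_nhds hxy)) self_mem_nhdsWithin, ?_⟩
      rw [ae_iff] at hy
      refine measure_mono_null ?_ hy
      rintro z ⟨hz1, hz2⟩
      show ¬ _
      rw [indicator_of_mem hz1]
      exact hz2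
    · intro h
      refine le_antisymm (iSup₂_le fun r hr => le_of_eq ?_) zero_le
      rw [mixedE_zero_iff hs (inn_meas n p e r hg)]
      refine ae_of_all _ fun y => ?_
      unfold inn
      rw [(mixedE_zero_iff hp (ind_meas n y r hg)).2, mul_zero]
      filter_upwards [h] with x hx
      simp [indicator, hx]
  sup {g} hg hm := by
    refine iSup₂_le fun r hr => ?_
    calc mixedE n s (inn n p e r fun x => ⨆ k, g k x)
        ≤ mixedE n s (fun y => ⨆ k, inn n p e r (g k) y) := by
          refine mixedE_mono hs fun y => ?_
          unfold inn
          rw [← ENNReal.mul_iSup]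
          gcongr
          refine le_trans (mixedE_mono hp fun x => ?_)
            (mixedE_iSup hp (fun k => ind_meas n y r (hg k)) fun x i j hij => ?_)
          · by_cases hx : x ∈ eball n y r <;> simp [hx]
          · exact indicator_le_indicator (hm x hij)
      _ ≤ ⨆ k, mixedE n s (inn n p e r (g k)) := by
          refine mixedE_iSup hs (fun k => inn_meas n p e r (hg k)) fun y i j hij => ?_
          unfold inn
          dsimp only
          gcongr
          exact mixedE_mono hp fun x => indicator_le_indicator (hm x hij)
      _ ≤ _ := iSup_mono fun k =>
          le_iSup₂ (f := fun (r : ℝ) (_ : r ∈ S) => mixedE n s (inn n p e r (g k))) r hr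
  loc {g} hg h K hK := by
    obtain ⟨r, hr⟩ := hne
    have h1 : mixedE n s (inn n p e r g) ≠ ∞ := ne_top_of_le_ne_top h
      (le_iSup₂ (f := fun (r : ℝ) (_ : r ∈ S) => mixedE n s (inn n p e r g)) r hr)
    have h2 := ae_lt_top_of_loc (inn_meas n p e r hg)
      (fun K hK => mixedE_loc' hs (inn_meas n p e r hg) h1 hK.isBounded)
    have h3 : ∀ᵐ y, ∫⁻ x in eball n y r, g x ≠ ∞ := by
      filter_upwards [h2] with y hy
      have h4 : mixedE n p ((eball n y r).indicator g) ≠ ∞ := by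
        intro h5
        unfold inn at hy
        rw [h5, ENNReal.mul_top (eball_pow_ne_zero n y (hS r hr) e)] at hy
        exact lt_irrefl _ hy
      have h6 := mixedE_loc' hp (ind_meas n y r hg) h4 (eball_bdd n y (hS r hr))
      rwa [setLIntegral_congr_fun (g := g) (eball_open n y r).measurableSet
        (fun x hx => indicator_of_mem hx g)] at h6
    refine hK.induction_on (p := fun s => ∫⁻ x in s, g x ≠ ∞) (by simp)
      (fun s t hst ht => ne_top_of_le_ne_top ht (lintegral_mono_set hst))
      (fun s t hs ht => ne_top_of_le_ne_top (ENNReal.add_ne_top.2 ⟨hs, ht⟩)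
        (lintegral_union_le _ _ _)) fun x _ => ?_
    obtain ⟨y, hy, hxy⟩ := exists_center (hS r hr) h3 x
    exact ⟨_, mem_nhdsWithin_of_mem_nhds ((eball_open n y r).mem_nhds hxy), hy⟩

lemma mixedLp_ind (n : ℕ) (p : Fin n → ℝ≥0∞) (f : (Fin n → ℝ) → ℝ) (B : Set (Fin n → ℝ)) :
    mixedLp n p (B.indicator f) = mixedE n p (B.indicator fun x => (‖f x‖₊ : ℝ≥0∞)) := by
  unfold mixedLp
  congr 1
  funext x
  by_cases hx : x ∈ B <;> simp [hx]

lemma amalgamNorm_eq (n : ℕ) (p s : Fin n → ℝ≥0∞) :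
    amalgamNorm n p s = IsFNorm.app (NN n p s 0 {1}) := by
  funext f
  simp only [amalgamNorm, amalgamNormR, IsFNorm.app, NN, mem_singleton_iff, iSup_iSup_eq_left]
  congr 1
  funext y
  simp only [inn, ENNReal.rpow_zero, one_mul, mixedLp_ind]

lemma amalgamNormA_eq (n : ℕ) (p s : Fin n → ℝ≥0∞) (α : ℝ≥0∞) :
    amalgamNormA n p s α = IsFNorm.app (NN n p s
      ((1 / α).toReal - invSum n p / (n : ℝ) - invSum n s / (n : ℝ)) (Ioi 0)) := by
  funext f
  simp only [amalgamNormA, IsFNorm.app, NN, mem_Ioi, mixedLp_ind]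
  rfl

/-- The mixed-norm amalgam spaces `(L^{p⃗},L^{s⃗})(ℝⁿ)` and
`(L^{p⃗},L^{s⃗})^α(ℝⁿ)` are Banach spaces: the functionals are norms
(triangle inequality, homogeneity, positivity) and every Cauchy sequence converges. -/
theorem statement0 (n : ℕ) (hn : 1 ≤ n) (p s : Fin n → ℝ≥0∞) (α : ℝ≥0∞)
    (hp : ∀ i, 1 ≤ p i) (hs : ∀ i, 1 ≤ s i) (hα : 1 ≤ α) :
    (∀ f g : (Fin n → ℝ) → ℝ, LocallyIntegrable f volume → LocallyIntegrable g volume →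
      amalgamNorm n p s (f + g) ≤ amalgamNorm n p s f + amalgamNorm n p s g) ∧
    (∀ (c : ℝ) (f : (Fin n → ℝ) → ℝ),
      amalgamNorm n p s (c • f) = (‖c‖₊ : ℝ≥0∞) * amalgamNorm n p s f) ∧
    (∀ f : (Fin n → ℝ) → ℝ, LocallyIntegrable f volume →
      (amalgamNorm n p s f = 0 ↔ f =ᵐ[volume] 0)) ∧
    (∀ F : ℕ → (Fin n → ℝ) → ℝ,
      (∀ j, LocallyIntegrable (F j) volume) →
      (∀ j, amalgamNorm n p s (F j) < ∞) →
      (∀ ε : ℝ≥0∞, 0 < ε → ∃ N : ℕ, ∀ j ≥ N, ∀ k ≥ N,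
        amalgamNorm n p s (F j - F k) < ε) →
      ∃ f : (Fin n → ℝ) → ℝ, LocallyIntegrable f volume ∧ amalgamNorm n p s f < ∞ ∧
        Tendsto (fun j => amalgamNorm n p s (F j - f)) atTop (𝓝 0)) ∧
    (∀ f g : (Fin n → ℝ) → ℝ, LocallyIntegrable f volume → LocallyIntegrable g volume →
      amalgamNormA n p s α (f + g) ≤ amalgamNormA n p s α f + amalgamNormA n p s α g) ∧
    (∀ (c : ℝ) (f : (Fin n → ℝ) → ℝ),
      amalgamNormA n p s α (c • f) = (‖c‖₊ : ℝ≥0∞) * amalgamNormA n p s α f) ∧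
    (∀ f : (Fin n → ℝ) → ℝ, LocallyIntegrable f volume →
      (amalgamNormA n p s α f = 0 ↔ f =ᵐ[volume] 0)) ∧
    (∀ F : ℕ → (Fin n → ℝ) → ℝ,
      (∀ j, LocallyIntegrable (F j) volume) →
      (∀ j, amalgamNormA n p s α (F j) < ∞) →
      (∀ ε : ℝ≥0∞, 0 < ε → ∃ N : ℕ, ∀ j ≥ N, ∀ k ≥ N,
        amalgamNormA n p s α (F j - F k) < ε) →
      ∃ f : (Fin n → ℝ) → ℝ, LocallyIntegrable f volume ∧ amalgamNormA n p s α f < ∞ ∧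
        Tendsto (fun j => amalgamNormA n p s α (F j - f)) atTop (𝓝 0)) := by
  rw [amalgamNorm_eq, amalgamNormA_eq]
  have h1 := isFNorm n hp hs 0 (S := {1}) (by simp) (singleton_nonempty _)
  have h2 := isFNorm n hp hs ((1 / α).toReal - invSum n p / (n : ℝ) - invSum n s / (n : ℝ))
    (S := Ioi 0) (fun r hr => hr) nonempty_Ioi
  have hm : ∀ {f : (Fin n → ℝ) → ℝ}, LocallyIntegrable f volume → AEMeasurable f volume :=
    fun h => h.aestronglyMeasurable.aemeasurable
  exact ⟨fun f g hf hg => h1.app_add (hm hf) (hm hg), h1.app_smul,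
    fun f hf => h1.app_zero (hm hf), h1.complete,
    fun f g hf hg => h2.app_add (hm hf) (hm hg), h2.app_smul,
    fun f hf => h2.app_zero (hm hf), h2.complete⟩

end MixedAmalgam

end
end

section
/- Let n ≥ 1, let p⃗, s⃗ be n-tuples with 1 ≤ pᵢ, sᵢ ≤ ∞ and let 1 ≤ α ≤ ∞ satisfy (1/n)Σᵢ 1/sᵢ ≤ 1/α ≤ (1/n)Σᵢ 1/pᵢ. Then there is a constant C > 0, independent of f, such that ‖f‖_{(L^{p⃗},L^{s⃗})} ≤ C·‖f‖_{(L^{p⃗},L^{s⃗})^α} for every locally integrable f; in particular (L^{p⃗},L^{s⃗})^α(ℝⁿ) ⊂ (L^{p⃗},L^{s⃗})(ℝⁿ). -/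
open MeasureTheory ENNReal Filter Topology Set

noncomputable section

namespace MixedAmalgam

theorem lpInt_const_mul_le (p : ℝ≥0∞) (hp : 1 ≤ p) (c : ℝ≥0∞) (hc : c ≠ ∞) (g : ℝ → ℝ≥0∞) :
    lpInt p (fun t => c * g t) = c * lpInt p g := by
  unfold lpInt
  split_ifs with h
  · exact ENNReal.essSup_const_mul
  · have h0 : 0 < p.toReal := ENNReal.toReal_pos (by positivity) h
    have h1 : ∀ t, (c * g t) ^ p.toReal = c ^ p.toReal * g t ^ p.toReal := fun t =>
      ENNReal.mul_rpow_of_nonneg _ _ h0.le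
    simp_rw [h1]
    rw [lintegral_const_mul' _ _ (ENNReal.rpow_ne_top_of_nonneg h0.le hc),
      ENNReal.mul_rpow_of_nonneg _ _ (by positivity), ← ENNReal.rpow_mul,
      mul_one_div_cancel h0.ne', ENNReal.rpow_one]

theorem mixedE_const_mul (n : ℕ) (p : Fin n → ℝ≥0∞) (hp : ∀ i, 1 ≤ p i) (c : ℝ≥0∞) (hc : c ≠ ∞)
    (g : (Fin n → ℝ) → ℝ≥0∞) :
    mixedE n p (fun x => c * g x) = c * mixedE n p g := by
  induction n with
  | zero => rfl
  | succ n ih =>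
    simp only [mixedE]
    rw [← lpInt_const_mul_le _ (hp _) _ hc]
    congr 1
    funext t
    exact ih _ (fun i => hp _) _

theorem volume_eball (n : ℕ) (y : Fin n → ℝ) (r : ℝ) :
    volume (eball n y r) = volume (eball n 0 r) := by
  have : eball n y r = (fun x => x + -y) ⁻¹' (eball n 0 r) := by
    ext x; simp [eball, sub_eq_add_neg]
  rw [this, measure_preimage_add_right]

theorem volume_eball_pos (n : ℕ) : volume (eball n 0 1) ≠ 0 := by
  have ho : IsOpen (eball n 0 1) := by
    unfold eball
    exact isOpen_lt (by fun_prop) continuous_const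
  exact (ho.measure_pos volume ⟨0, by simp [eball]⟩).ne'

theorem volume_eball_lt (n : ℕ) : volume (eball n 0 1) ≠ ∞ := by
  have : eball n 0 1 ⊆ Metric.closedBall 0 1 := by
    intro x hx
    simp only [eball, mem_setOf_eq, Pi.zero_apply, sub_zero] at hx
    rw [mem_closedBall_zero_iff, pi_norm_le_iff_of_nonneg zero_le_one]
    intro i
    rw [Real.norm_eq_abs, ← Real.sqrt_sq_eq_abs]
    exact (Real.sqrt_le_sqrt (Finset.single_le_sum (f := fun i => x i ^ 2)
      (fun i _ => sq_nonneg (x i)) (Finset.mem_univ i))).trans hx.le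
  exact ((measure_mono this).trans_lt measure_closedBall_lt_top).ne

/-- `(L^{p⃗},L^{s⃗})^α(ℝⁿ) ⊂ (L^{p⃗},L^{s⃗})(ℝⁿ)` with
`‖f‖_{(L^{p⃗},L^{s⃗})} ≤ C ‖f‖_{(L^{p⃗},L^{s⃗})^α}`. -/
theorem statement2 (n : ℕ) (hn : 1 ≤ n) (p s : Fin n → ℝ≥0∞) (α : ℝ≥0∞)
    (hp : ∀ i, 1 ≤ p i) (hs : ∀ i, 1 ≤ s i) (hα : 1 ≤ α)
    (hα1 : invSum n s / (n : ℝ) ≤ (1 / α).toReal)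
    (hα2 : (1 / α).toReal ≤ invSum n p / (n : ℝ)) :
    ∃ C : ℝ≥0∞, 0 < C ∧ C < ∞ ∧
      ∀ f : (Fin n → ℝ) → ℝ, LocallyIntegrable f volume →
        amalgamNorm n p s f ≤ C * amalgamNormA n p s α f := by
  set e := (1 / α).toReal - invSum n p / (n : ℝ) - invSum n s / (n : ℝ) with he
  set V := volume (eball n 0 1) with hV
  have hV0 : V ≠ 0 := volume_eball_pos n
  have hV1 : V ≠ ∞ := volume_eball_lt n
  have hc0 : V ^ e ≠ 0 := (ENNReal.rpow_pos (pos_iff_ne_zero.2 hV0) hV1).ne'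
  have hc1 : V ^ e ≠ ∞ := ENNReal.rpow_ne_top_of_ne_zero hV0 hV1
  refine ⟨(V ^ e)⁻¹, ENNReal.inv_pos.2 hc1, ENNReal.inv_lt_top.2 (pos_iff_ne_zero.2 hc0), ?_⟩
  intro f _
  have h1 : V ^ e * amalgamNorm n p s f ≤ amalgamNormA n p s α f := by
    unfold amalgamNorm amalgamNormR amalgamNormA
    rw [← mixedE_const_mul n s hs _ hc1]
    refine le_trans (le_of_eq ?_) (le_iSup₂ (1 : ℝ) one_pos)
    simp only [volume_eball n _ 1, ← hV, ← he]
  calc amalgamNorm n p s f = (V ^ e)⁻¹ * (V ^ e * amalgamNorm n p s f) := by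
        rw [← mul_assoc, ENNReal.inv_mul_cancel hc0 hc1, one_mul]
    _ ≤ _ := by gcongr

end MixedAmalgam

end
end
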